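/- Correctness of Madani's algorithm for discounted deterministic MDPs: let n = |S|, define d_0(x) = 0 and d_k(x) = min_{u ∈ A} [ g(x, u) + λ · d_{k−1}(f(x, u)) ] for 1 ≤ k ≤ n; define y_0(x) = max_{0 ≤ k < n} ( d_n(x) − λ^{n−k} · d_k(x) ) / ( 1 − λ^{n−k} ), and y_k(x) = min_{u ∈ A} [ g(x, u) + λ · y_{k−1}(f(x, u)) ] for 1 ≤ k ≤ n − 1. Then for every x ∈ S, the optimal value function satisfies v_*(x) = min_{0 ≤ k < n} y_k(x). -/

import Mathlib

/-- Closed-loop trajectory under a stationary policy. -/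
def ctraj {S A : Type*} (f : S → A → S) (pol : S → A) (x : S) : ℕ → S
  | 0 => x
  | t + 1 => f (ctraj f pol x t) (pol (ctraj f pol x t))

/-- Value function of a stationary policy. -/
noncomputable def vpi {S A : Type*} (f : S → A → S) (g : S → A → ℝ) (lam : ℝ)
    (pol : S → A) (x : S) : ℝ :=
  ∑' t : ℕ, lam ^ t * g (ctraj f pol x t) (pol (ctraj f pol x t))

/-- Optimal value function: minimum over stationary policies. -/
noncomputable def vstar {S A : Type*} (f : S → A → S) (g : S → A → ℝ) (lam : ℝ)
    (x : S) : ℝ :=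
  ⨅ pol : S → A, vpi f g lam pol x

/-- Finite-horizon optimal discounted costs: d_0 = 0,
d_k(x) = min_u [ g(x,u) + lam * d_{k-1}(f(x,u)) ]. -/
noncomputable def dk {S A : Type*} (f : S → A → S) (g : S → A → ℝ) (lam : ℝ) :
    ℕ → S → ℝ
  | 0, _ => 0
  | k + 1, x => ⨅ u : A, (g x u + lam * dk f g lam k (f x u))
/-- The sequence of value functions in Madani's algorithm:
y_0(x) = max_{0 ≤ k < n} (d_n(x) - lam^{n-k} d_k(x)) / (1 - lam^{n-k}),
y_k(x) = min_u [ g(x,u) + lam * y_{k-1}(f(x,u)) ] for k ≥ 1. -/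
noncomputable def madaniY {S A : Type*} (f : S → A → S) (g : S → A → ℝ) (lam : ℝ)
    (n : ℕ) : ℕ → S → ℝ
  | 0, x => ⨆ k : Fin n,
      (dk f g lam n x - lam ^ (n - (k : ℕ)) * dk f g lam (k : ℕ) x) /
        (1 - lam ^ (n - (k : ℕ)))
  | k + 1, x => ⨅ u : A, (g x u + lam * madaniY f g lam n k (f x u))

section aux

variable {S A : Type*} [Fintype S] [Nonempty S] [Fintype A] [Nonempty A]
  (f : S → A → S) (g : S → A → ℝ) (lam : ℝ)

theorem aux_inf_le (F : A → ℝ) (u : A) : (⨅ u, F u) ≤ F u :=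
  ciInf_le (Set.finite_range F).bddBelow u

theorem aux_bellman (hlam0 : 0 < lam) (hlam1 : lam < 1) :
    ∃ w : S → ℝ, ∀ x, w x = ⨅ u : A, (g x u + lam * w (f x u)) := by
  let T : (S → ℝ) → (S → ℝ) := fun w x => ⨅ u : A, (g x u + lam * w (f x u))
  have key : ∀ v w : S → ℝ, ∀ x, T v x ≤ T w x + lam * dist v w := by
    intro v w x
    obtain ⟨u, hu⟩ := exists_eq_ciInf_of_finite (f := fun u : A => g x u + lam * w (f x u))
    have h1 : T v x ≤ g x u + lam * v (f x u) := aux_inf_le (fun u => g x u + lam * v (f x u)) u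
    have h2 : T w x = g x u + lam * w (f x u) := hu.symm
    have h3 : v (f x u) - w (f x u) ≤ dist v w :=
      (le_abs_self _).trans ((Real.dist_eq _ _).symm.le.trans (dist_le_pi_dist v w (f x u)))
    have h4 := mul_le_mul_of_nonneg_left h3 hlam0.le
    rw [mul_sub] at h4
    linarith
  have hc : ContractingWith ⟨lam, hlam0.le⟩ T := by
    refine ⟨by exact_mod_cast hlam1, LipschitzWith.of_dist_le_mul ?_⟩
    intro v w
    refine (dist_pi_le_iff (by positivity)).2 ?_
    intro x
    rw [Real.dist_eq, abs_le]
    have a := key v w x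
    have b := key w v x
    rw [dist_comm w v] at b
    change -(lam * dist v w) ≤ _ ∧ _ ≤ lam * dist v w
    constructor <;> linarith
  have hfix := hc.fixedPoint_isFixedPt
  exact ⟨_, fun x => (congrFun hfix x).symm⟩

theorem aux_ctraj_shift (pol : S → A) (x : S) (t : ℕ) :
    ctraj f pol x (t + 1) = ctraj f pol (f x (pol x)) t := by
  induction t with
  | zero => rfl
  | succ t ih =>
    rw [ctraj, ih]
    rfl

theorem aux_vpi (hlam0 : 0 < lam) (hlam1 : lam < 1) (pol : S → A) (x : S) :
    vpi f g lam pol x = g x (pol x) + lam * vpi f g lam pol (f x (pol x)) := by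
  have hs : ∀ x, Summable fun t : ℕ =>
      lam ^ t * g (ctraj f pol x t) (pol (ctraj f pol x t)) := by
    intro x
    obtain ⟨B, hB⟩ := (Set.finite_range (fun z => |g z (pol z)|)).bddAbove
    refine Summable.of_norm_bounded (g := fun t : ℕ => lam ^ t * B)
      ((summable_geometric_of_lt_one hlam0.le hlam1).mul_right B) ?_
    intro t
    rw [Real.norm_eq_abs, abs_mul, abs_of_pos (pow_pos hlam0 t)]
    exact mul_le_mul_of_nonneg_left (hB ⟨_, rfl⟩) (pow_pos hlam0 t).le
  unfold vpi
  rw [(hs x).tsum_eq_zero_add, ← tsum_mul_left]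
  congr 1
  · simp [ctraj]
  · refine tsum_congr fun t => ?_
    rw [aux_ctraj_shift, pow_succ]
    ring

theorem aux_cmp (hlam0 : 0 < lam) (hlam1 : lam < 1) (h : S → S) (D : S → ℝ)
    (hD : ∀ x, D x ≤ lam * D (h x)) (x : S) : D x ≤ 0 := by
  obtain ⟨z, hz⟩ := Finite.exists_max D
  have h1 := hD z
  have h2 := mul_le_mul_of_nonneg_left (hz (h z)) hlam0.le
  have h3 : D z ≤ 0 := by
    by_contra hc
    push Not at hc
    nlinarith
  exact (hz x).trans h3

theorem aux_vstar (hlam0 : 0 < lam) (hlam1 : lam < 1) (w : S → ℝ)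
    (hw : ∀ x, w x = ⨅ u : A, (g x u + lam * w (f x u)))
    (pol : S → A) (hp : ∀ x, w x = g x (pol x) + lam * w (f x (pol x))) (x : S) :
    vstar f g lam x = w x := by
  have hle : ∀ q : S → A, w x ≤ vpi f g lam q x := by
    intro q
    have := aux_cmp lam hlam0 hlam1 (fun z => f z (q z)) (fun z => w z - vpi f g lam q z) ?_ x
    · simpa using this
    · intro z
      have h1 := aux_vpi f g lam hlam0 hlam1 q z
      have h2 := aux_inf_le (fun u => g z u + lam * w (f z u)) (q z)
      rw [← hw z] at h2
      try simp only at h2 ⊢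
      rw [mul_sub]
      linarith
  apply le_antisymm
  · have h1 : vstar f g lam x ≤ vpi f g lam pol x := by
      refine ciInf_le ⟨w x, ?_⟩ pol
      rintro _ ⟨q, rfl⟩
      exact hle q
    refine h1.trans ?_
    have := aux_cmp lam hlam0 hlam1 (fun z => f z (pol z))
      (fun z => vpi f g lam pol z - w z) ?_ x
    · simpa using this
    · intro z
      have h1 := aux_vpi f g lam hlam0 hlam1 pol z
      have h2 := hp z
      try simp only
      rw [mul_sub]
      linarith
  · exact le_ciInf hle

/-- telescoping upper bound along a walk -/
theorem aux_walk (hlam0 : 0 < lam) (xs : ℕ → S) (u : ℕ → A)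
    (hxs : ∀ t, xs (t + 1) = f (xs t) (u t)) (phi : ℕ → S → ℝ)
    (hphi : ∀ k x a, phi (k + 1) x ≤ g x a + lam * phi k (f x a)) (m : ℕ) :
    ∀ k s, phi (k + m) (xs s) ≤
      ∑ t ∈ Finset.range m, lam ^ t * g (xs (s + t)) (u (s + t))
        + lam ^ m * phi k (xs (s + m)) := by
  induction m with
  | zero => intro k s; simp
  | succ m ih =>
    intro k s
    have h1 := ih (k + 1) s
    have h2 := hphi k (xs (s + m)) (u (s + m))
    rw [← hxs] at h2
    have h3 := mul_le_mul_of_nonneg_left h2 (pow_pos hlam0 m).le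
    rw [Finset.sum_range_succ]
    have e : k + (m + 1) = k + 1 + m := by ring
    rw [e, pow_succ]
    have e2 : s + (m + 1) = s + m + 1 := by ring
    rw [e2]
    linarith

theorem aux_walk_eq (xs : ℕ → S) (u : ℕ → A) (n : ℕ)
    (hd : ∀ t, t < n → dk f g lam (n - t) (xs t)
      = g (xs t) (u t) + lam * dk f g lam (n - (t + 1)) (xs (t + 1))) (s m : ℕ) :
    s + m ≤ n → dk f g lam (n - s) (xs s) =
      ∑ t ∈ Finset.range m, lam ^ t * g (xs (s + t)) (u (s + t))
        + lam ^ m * dk f g lam (n - (s + m)) (xs (s + m)) := by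
  induction m with
  | zero => intro _; simp
  | succ m ih =>
    intro hm
    rw [ih (by omega), Finset.sum_range_succ, hd (s + m) (by omega), pow_succ]
    have e2 : s + (m + 1) = s + m + 1 := by ring
    rw [e2]
    ring

theorem aux_pigeon (xs : ℕ → S) :
    ∃ i c, 0 < c ∧ i + c ≤ Fintype.card S ∧ xs (i + c) = xs i := by
  obtain ⟨a, b, hab, he⟩ := Fintype.exists_ne_map_eq_of_card_lt
    (fun t : Fin (Fintype.card S + 1) => xs t) (by simp)
  have hab' : (a : ℕ) ≠ b := fun h => hab (Fin.ext h)
  have ha := a.2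
  have hb := b.2
  try simp only at he
  rcases lt_or_gt_of_ne hab' with h | h
  · refine ⟨a, b - a, by omega, by omega, ?_⟩
    rw [show (a : ℕ) + (b - a) = b by omega, he]
  · refine ⟨b, a - b, by omega, by omega, ?_⟩
    rw [show (b : ℕ) + (a - b) = a by omega, he]

theorem aux_y0_ge (hlam0 : 0 < lam) (hlam1 : lam < 1) (w : S → ℝ)
    (hw : ∀ x, w x = ⨅ u : A, (g x u + lam * w (f x u))) (x : S) :
    w x ≤ madaniY f g lam (Fintype.card S) 0 x := by
  have hσ : ∀ k x, ∃ u, dk f g lam (k + 1) x = g x u + lam * dk f g lam k (f x u) := by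
    intro k x
    obtain ⟨u, hu⟩ := exists_eq_ciInf_of_finite
      (f := fun u : A => g x u + lam * dk f g lam k (f x u))
    exact ⟨u, hu.symm⟩
  choose σ hσ using hσ
  set n := Fintype.card S with hn
  let xs : ℕ → S := fun t => Nat.rec x (fun t y => f y (σ (n - (t + 1)) y)) t
  let u : ℕ → A := fun t => σ (n - (t + 1)) (xs t)
  have hxs : ∀ t, xs (t + 1) = f (xs t) (u t) := fun t => rfl
  have hx0 : xs 0 = x := rfl
  have hd : ∀ t, t < n → dk f g lam (n - t) (xs t)
      = g (xs t) (u t) + lam * dk f g lam (n - (t + 1)) (xs (t + 1)) := by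
    intro t ht
    have := hσ (n - (t + 1)) (xs t)
    rwa [show n - (t + 1) + 1 = n - t by omega] at this
  obtain ⟨i, c, hc, hic, he⟩ := aux_pigeon xs
  rw [← hn] at hic
  have e1 := aux_walk_eq f g lam xs u n hd 0 i (by omega)
  have e2 := aux_walk_eq f g lam xs u n hd i c hic
  have i1 := aux_walk f g lam hlam0 xs u hxs (dk f g lam)
    (fun k x a => aux_inf_le (fun u => g x u + lam * dk f g lam k (f x u)) a) i (n - (i + c)) 0
  have hwi : ∀ (k : ℕ) x a, (fun _ : ℕ => w) (k + 1) x
      ≤ g x a + lam * (fun _ : ℕ => w) k (f x a) := by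
    intro k x a
    have := aux_inf_le (fun u => g x u + lam * w (f x u)) a
    rw [← hw x] at this
    exact this
  have i2 := aux_walk f g lam hlam0 xs u hxs (fun _ => w) hwi i 0 0
  have i3 := aux_walk f g lam hlam0 xs u hxs (fun _ => w) hwi c 0 i
  rw [he] at e2 i3
  simp only [zero_add, Nat.sub_zero, hx0] at e1 e2 i1 i2 i3
  rw [show n - (i + c) + i = n - c by omega] at i1
  have hlc : lam ^ c < 1 := pow_lt_one₀ hlam0.le hlam1 (by omega)
  have hlc0 : 0 < lam ^ c := pow_pos hlam0 c
  have hli0 : 0 < lam ^ i := pow_pos hlam0 i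
  have hlt : n - c < n := by omega
  have hk := le_ciSup (f := fun k : Fin n =>
      (dk f g lam n x - lam ^ (n - (k : ℕ)) * dk f g lam (k : ℕ) x) /
        (1 - lam ^ (n - (k : ℕ)))) (Set.finite_range _).bddAbove ⟨n - c, hlt⟩
  refine le_trans ?_ hk
  try simp only
  rw [show n - (n - c) = c by omega, le_div_iff₀ (by linarith)]
  generalize ∑ t ∈ Finset.range i, lam ^ t * g (xs t) (u t) = P at *
  generalize ∑ t ∈ Finset.range c, lam ^ t * g (xs (i + t)) (u (i + t)) = C at *
  generalize dk f g lam (n - (i + c)) (xs i) = Q at *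
  rw [e2] at e1
  rw [e1]
  have j1 := mul_le_mul_of_nonneg_left i1 hlc0.le
  have j2 := mul_le_mul_of_nonneg_right i2 (show 0 ≤ 1 - lam ^ c by linarith)
  have j3 := mul_le_mul_of_nonneg_left i3 hli0.le
  linarith

theorem aux_y_ge (hlam0 : 0 < lam) (hlam1 : lam < 1) (w : S → ℝ)
    (hw : ∀ x, w x = ⨅ u : A, (g x u + lam * w (f x u))) (k : ℕ) :
    ∀ x, w x ≤ madaniY f g lam (Fintype.card S) k x := by
  induction k with
  | zero => exact aux_y0_ge f g lam hlam0 hlam1 w hw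
  | succ k ih =>
    intro x
    refine le_ciInf fun u => ?_
    have h1 := aux_inf_le (fun u => g x u + lam * w (f x u)) u
    rw [← hw x] at h1
    have h2 := mul_le_mul_of_nonneg_left (ih (f x u)) hlam0.le
    try simp only at h1
    linarith

theorem aux_y_le (hlam0 : 0 < lam) (w : S → ℝ) (n : ℕ)
    (pol : S → A) (hp : ∀ x, w x = g x (pol x) + lam * w (f x (pol x))) (k : ℕ) :
    ∀ x, madaniY f g lam n 0 ((fun z => f z (pol z))^[k] x) ≤ w ((fun z => f z (pol z))^[k] x) →
      madaniY f g lam n k x ≤ w x := by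
  induction k with
  | zero => intro x h; exact h
  | succ k ih =>
    intro x h
    have h1 := ih (f x (pol x)) h
    have h2 := aux_inf_le (fun u => g x u + lam * madaniY f g lam n k (f x u)) (pol x)
    have h3 := mul_le_mul_of_nonneg_left h1 hlam0.le
    have h4 := hp x
    change (⨅ u : A, (g x u + lam * madaniY f g lam n k (f x u))) ≤ w x
    try simp only at h2
    linarith

theorem aux_gap (hlam0 : 0 < lam) (w : S → ℝ)
    (pol : S → A) (hp : ∀ x, w x = g x (pol x) + lam * w (f x (pol x))) (m : ℕ) :
    ∀ k z, dk f g lam (k + m) z - w z ≤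
      lam ^ m * (dk f g lam k ((fun z => f z (pol z))^[m] z) - w ((fun z => f z (pol z))^[m] z)) := by
  induction m with
  | zero => intro k z; simp
  | succ m ih =>
    intro k z
    have h1 := ih k (f z (pol z))
    have h2 : dk f g lam (k + m + 1) z ≤ _ :=
      aux_inf_le (fun u => g z u + lam * dk f g lam (k + m) (f z u)) (pol z)
    have h3 := mul_le_mul_of_nonneg_left h1 hlam0.le
    have h4 := hp z
    rw [Function.iterate_succ_apply, pow_succ, ← add_assoc]
    try simp only at h2
    linarith

theorem aux_exists (hlam0 : 0 < lam) (hlam1 : lam < 1) (w : S → ℝ)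
    (pol : S → A) (hp : ∀ x, w x = g x (pol x) + lam * w (f x (pol x))) (x : S) :
    ∃ k : Fin (Fintype.card S), madaniY f g lam (Fintype.card S) k x ≤ w x := by
  have gap := aux_gap f g lam hlam0 w pol hp
  have yle := aux_y_le f g lam hlam0 w (Fintype.card S) pol hp
  set h : S → S := fun z => f z (pol z) with hh
  obtain ⟨i, c, hc, hic, he⟩ := aux_pigeon (fun t => h^[t] x)
  have hnpos : 0 < Fintype.card S := Fintype.card_pos
  set n := Fintype.card S with hn
  set p := h^[i] x with hpdef
  have hper : Function.IsPeriodicPt h c p := by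
    change h^[c] (h^[i] x) = h^[i] x
    rw [← Function.iterate_add_apply, add_comm]
    exact he
  haveI : Nonempty (Fin c × Fin n) := ⟨⟨⟨0, hc⟩, ⟨0, hnpos⟩⟩⟩
  obtain ⟨⟨s, k⟩, hmin⟩ := Finite.exists_min (fun q : Fin c × Fin n =>
    (dk f g lam q.2 (h^[(q.1 : ℕ)] p) - w (h^[(q.1 : ℕ)] p)) / lam ^ (q.2 : ℕ))
  try simp only at hmin
  have hkn := k.2
  let s' : ℕ := ((n - k) * (c - 1) + s) % c
  have hs' : s' < c := Nat.mod_lt _ hc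
  set z := h^[s'] p with hz
  have hback : h^[n - k] z = h^[(s : ℕ)] p := by
    rw [hz, hper.iterate_mod_apply, ← Function.iterate_add_apply]
    have e : (n - (k : ℕ)) + ((n - k) * (c - 1) + s) = s + c * (n - k) := by
      obtain ⟨c', rfl⟩ : ∃ c', c = c' + 1 := ⟨c - 1, by omega⟩
      simp only [Nat.add_sub_cancel]
      ring
    rw [e, Function.iterate_add_apply, (hper.mul_const (n - k)).eq]
  have hg := gap (n - k) k z
  rw [hback, show (k : ℕ) + (n - k) = n by omega] at hg
  have hy0 : madaniY f g lam n 0 z ≤ w z := by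
    haveI : Nonempty (Fin n) := ⟨k⟩
    refine ciSup_le fun j => ?_
    have hj := j.2
    have hm := hmin (⟨s', hs'⟩, j)
    simp only [← hz] at hm
    have hlc : lam ^ (n - (j : ℕ)) < 1 := pow_lt_one₀ hlam0.le hlam1 (by omega)
    rw [div_le_iff₀ (by linarith)]
    have h1 := mul_le_mul_of_nonneg_left hm (pow_pos hlam0 n).le
    have p1 : ∀ j : Fin n, lam ^ n = lam ^ (n - (j : ℕ)) * lam ^ (j : ℕ) := by
      intro j
      have := j.2
      rw [← pow_add]; congr 1; omega
    have p2 : ∀ (j : Fin n) (a : ℝ), lam ^ n * (a / lam ^ (j : ℕ)) = lam ^ (n - (j : ℕ)) * a := by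
      intro j a
      have := (pow_pos hlam0 (j : ℕ)).ne'
      rw [p1 j]; field_simp
    rw [p2, p2] at h1
    linarith
  refine ⟨⟨s' + i, by omega⟩, yle (s' + i) x ?_⟩
  rw [Function.iterate_add_apply]
  exact hy0

end aux

theorem madani_algorithm_correct
    {S A : Type*} [Fintype S] [Nonempty S] [Fintype A] [Nonempty A]
    (f : S → A → S) (g : S → A → ℝ) (lam : ℝ) (hlam0 : 0 < lam) (hlam1 : lam < 1)
    (x : S) :
    vstar f g lam x =
      ⨅ k : Fin (Fintype.card S), madaniY f g lam (Fintype.card S) (k : ℕ) x := by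
  obtain ⟨w, hw⟩ := aux_bellman f g lam hlam0 hlam1
  have hp : ∀ x, ∃ u, w x = g x u + lam * w (f x u) := by
    intro x
    obtain ⟨u, hu⟩ := exists_eq_ciInf_of_finite (f := fun u : A => g x u + lam * w (f x u))
    exact ⟨u, (hw x).trans hu.symm⟩
  choose pol hp using hp
  rw [aux_vstar f g lam hlam0 hlam1 w hw pol hp x]
  haveI : Nonempty (Fin (Fintype.card S)) := ⟨⟨0, Fintype.card_pos⟩⟩
  apply le_antisymm
  · exact le_ciInf fun k => aux_y_ge f g lam hlam0 hlam1 w hw k x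
  · obtain ⟨k, hk⟩ := aux_exists f g lam hlam0 hlam1 w pol hp x
    exact (ciInf_le (Set.finite_range _).bddBelow k).trans hk
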